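/- arXiv:1601.04598 — 5 statements merged into one kernel-verified Lean document; each statement's English description precedes it below -/
import Mathlib

section
/- Let J = {J_m}_{m∈ℤ} be a sequence of reals with J_m ≥ 0, J_{-m} = J_m, J_0 = 0, and ∑_{m∈ℤ} J_m < ∞. Set M* = max_{q ∈ [−π,π]} 4 ∑_{m=1}^∞ J_m sin²(qm/2) (the maximum exists since the series defines a continuous function of q). Then the spectrum of the bounded self-adjoint operator −ℒ on ℓ²(ℤ;ℂ) equals the real interval [0, M*], viewed as a subset of ℂ. -/
open scoped BigOperators

/-- The isometry `(u_n) ↦ (w_n u_{e n})` of `ℓ²(ι)` attached to a permutation `e` of the index set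
and a family `w` of unimodular weights. -/
noncomputable def weightedPerm {ι : Type*} (e : ι ≃ ι) (w : ι → Circle) :
    lp (fun _ : ι => ℂ) 2 ≃ₗᵢ[ℂ] lp (fun _ : ι => ℂ) 2 where
  toFun u := ⟨fun n => w n * u (e n), memℓp_gen (by
    have h := (lp.memℓp u).summable (by norm_num)
    simpa [Function.comp_def, Circle.norm_coe] using (e.summable_iff.mpr h))⟩
  invFun u := ⟨fun n => (w (e.symm n))⁻¹ * u (e.symm n), memℓp_gen (by
    have h := (lp.memℓp u).summable (by norm_num)
    simpa [Function.comp_def, Circle.norm_coe] using (e.symm.summable_iff.mpr h))⟩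
  map_add' u v := by ext n; exact mul_add _ _ _
  map_smul' c u := by ext n; simp [mul_left_comm]
  left_inv u := by ext n; simp
  right_inv u := by ext n; simp
  norm_map' u := by
    rw [lp.norm_eq_tsum_rpow (by norm_num), lp.norm_eq_tsum_rpow (by norm_num)]
    congr 1
    simpa [Circle.norm_coe] using e.tsum_eq (fun n => ‖u n‖ ^ (2 : ENNReal).toReal)

lemma weightedPerm_apply {ι : Type*} (e : ι ≃ ι) (w : ι → Circle)
    (u : lp (fun _ : ι => ℂ) 2) (n : ι) : weightedPerm e w u n = w n * u (e n) := rfl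

lemma weightedPerm_symm_apply {ι : Type*} (e : ι ≃ ι) (w : ι → Circle)
    (u : lp (fun _ : ι => ℂ) 2) (n : ι) :
    (weightedPerm e w).symm u n = (w (e.symm n))⁻¹ * u (e.symm n) := rfl

/-- The bilateral shift `(u_n) ↦ (u_{n+1})` on `ℓ²(ℤ)`, as a unitary operator. -/
noncomputable def bilateralShift : unitary (lp (fun _ : ℤ => ℂ) 2 →L[ℂ] lp (fun _ : ℤ => ℂ) 2) :=
  Unitary.linearIsometryEquiv.symm (weightedPerm (Equiv.addRight 1) 1)

/-- The modulation `(u_n) ↦ (z ^ n u_n)` on `ℓ²(ℤ)`, as a unitary operator. -/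
noncomputable def modulation (z : Circle) :
    unitary (lp (fun _ : ℤ => ℂ) 2 →L[ℂ] lp (fun _ : ℤ => ℂ) 2) :=
  Unitary.linearIsometryEquiv.symm (weightedPerm (Equiv.refl ℤ) fun n => z ^ n)

lemma bilateralShift_apply (u : lp (fun _ : ℤ => ℂ) 2) (n : ℤ) :
    (bilateralShift : lp (fun _ : ℤ => ℂ) 2 →L[ℂ] lp (fun _ : ℤ => ℂ) 2) u n = u (n + 1) := by
  change weightedPerm (Equiv.addRight 1) 1 u n = _
  simp [weightedPerm_apply]

lemma star_bilateralShift_apply (u : lp (fun _ : ℤ => ℂ) 2) (n : ℤ) :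
    (star (bilateralShift : lp (fun _ : ℤ => ℂ) 2 →L[ℂ] lp (fun _ : ℤ => ℂ) 2)) u n
      = u (n - 1) := by
  have h := congrArg
    (fun A : lp (fun _ : ℤ => ℂ) 2 →L[ℂ] lp (fun _ : ℤ => ℂ) 2 => A u)
    (Unitary.coe_mul_star_self bilateralShift)
  have h' : ((bilateralShift : lp (fun _ : ℤ => ℂ) 2 →L[ℂ] lp (fun _ : ℤ => ℂ) 2)
      ((star (bilateralShift : lp (fun _ : ℤ => ℂ) 2 →L[ℂ] lp (fun _ : ℤ => ℂ) 2)) u)) (n - 1)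
        = u (n - 1) := congrArg (fun v : lp (fun _ : ℤ => ℂ) 2 => v (n - 1)) h
  rwa [bilateralShift_apply, sub_add_cancel] at h'

lemma modulation_apply (z : Circle) (u : lp (fun _ : ℤ => ℂ) 2) (n : ℤ) :
    (modulation z : lp (fun _ : ℤ => ℂ) 2 →L[ℂ] lp (fun _ : ℤ => ℂ) 2) u n = z ^ n * u n := by
  change weightedPerm (Equiv.refl ℤ) (fun n => z ^ n) u n = _
  simp [weightedPerm_apply]

lemma bilateralShift_pow_apply (k : ℕ) (u : lp (fun _ : ℤ => ℂ) 2) (n : ℤ) :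
    ((bilateralShift : lp (fun _ : ℤ => ℂ) 2 →L[ℂ] lp (fun _ : ℤ => ℂ) 2) ^ k) u n
      = u (n + k) := by
  induction k generalizing n with
  | zero => simp
  | succ k ih =>
    rw [pow_succ', mul_apply_eq_comp, bilateralShift_apply, ih]
    push_cast
    ring_nf

lemma star_bilateralShift_pow_apply (k : ℕ) (u : lp (fun _ : ℤ => ℂ) 2) (n : ℤ) :
    ((star (bilateralShift : lp (fun _ : ℤ => ℂ) 2 →L[ℂ] lp (fun _ : ℤ => ℂ) 2)) ^ k) u n
      = u (n - k) := by
  induction k generalizing n with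
  | zero => simp
  | succ k ih =>
    rw [pow_succ', mul_apply_eq_comp, star_bilateralShift_apply, ih]
    push_cast
    ring_nf

lemma bilateralShift_mul_modulation (z : Circle) :
    (bilateralShift : lp (fun _ : ℤ => ℂ) 2 →L[ℂ] lp (fun _ : ℤ => ℂ) 2) * modulation z
      = (z : ℂ) • (modulation z * bilateralShift) := by
  ext u n
  simp only [mul_apply_eq_comp, smul_apply, bilateralShift_apply,
    modulation_apply, lp.coeFn_smul, Pi.smul_apply, smul_eq_mul]
  rw [zpow_add_one₀ z.coe_ne_zero]
  ring

lemma smul_mem_spectrum_bilateralShift (z : Circle) {a : ℂ}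
    (ha : a ∈ spectrum ℂ
      (bilateralShift : lp (fun _ : ℤ => ℂ) 2 →L[ℂ] lp (fun _ : ℤ => ℂ) 2)) :
    (z : ℂ) * a ∈ spectrum ℂ
      (bilateralShift : lp (fun _ : ℤ => ℂ) 2 →L[ℂ] lp (fun _ : ℤ => ℂ) 2) := by
  set S : lp (fun _ : ℤ => ℂ) 2 →L[ℂ] lp (fun _ : ℤ => ℂ) 2 := ↑bilateralShift with hS
  let D := Unitary.toUnits (modulation z)
  have hconj : (↑D⁻¹ : lp (fun _ : ℤ => ℂ) 2 →L[ℂ] lp (fun _ : ℤ => ℂ) 2) * S * D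
      = Units.mk0 (z : ℂ) z.coe_ne_zero • S := by
    rw [mul_assoc, Units.inv_mul_eq_iff_eq_mul, Units.smul_def, mul_smul_comm]
    exact bilateralShift_mul_modulation z
  rw [← spectrum.units_conjugate' (u := D), hconj, spectrum.unit_smul_eq_smul]
  exact Set.smul_mem_smul_set ha

lemma spectrum_bilateralShift :
    spectrum ℂ (bilateralShift : lp (fun _ : ℤ => ℂ) 2 →L[ℂ] lp (fun _ : ℤ => ℂ) 2)
      = Metric.sphere 0 1 := by
  have hsub := spectrum.subset_circle_of_unitary (𝕜 := ℂ) bilateralShift.2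
  refine hsub.antisymm fun b hb => ?_
  have : Nontrivial (lp (fun _ : ℤ => ℂ) 2) :=
    ⟨⟨lp.single 2 (0 : ℤ) (1 : ℂ), 0, fun h => by
      simpa using congrArg (fun u : lp (fun _ : ℤ => ℂ) 2 => u 0) h⟩⟩
  obtain ⟨a, ha⟩ := spectrum.nonempty
    (bilateralShift : lp (fun _ : ℤ => ℂ) 2 →L[ℂ] lp (fun _ : ℤ => ℂ) 2)
  have ha1 : ‖a‖ = 1 := by simpa using hsub ha
  have hb1 : ‖b‖ = 1 := by simpa using hb
  have ha0 : a ≠ 0 := norm_ne_zero_iff.mp (by simp [ha1])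
  have h := smul_mem_spectrum_bilateralShift
    ⟨b / a, mem_sphere_zero_iff_norm.mpr (by rw [norm_div, ha1, hb1, div_one])⟩ ha
  change b / a * a ∈ _ at h
  rwa [div_mul_cancel₀ b ha0] at h

/-- If `c` is summable and `S` is a unitary with full spectrum, the spectrum of
`∑ c_m (2 - S^(m+1) - (S*)^(m+1))` is the range of the symbol `4 ∑ c_m sin²(q(m+1)/2)`. -/
lemma exists_hasSum_unitary_spectrum_eq {A : Type*} [CStarAlgebra A] {S : A}
    (hSU : S ∈ unitary A) (hσ : spectrum ℂ S = Metric.sphere 0 1)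
    {c : ℕ → ℝ} (hc : Summable c) :
    ∃ a : A, HasSum (fun m : ℕ => (c m : ℂ) • (2 - S ^ (m + 1) - star S ^ (m + 1))) a ∧
      spectrum ℂ a = Complex.ofReal ''
        ((fun q : ℝ => 4 * ∑' m : ℕ, c m * Real.sin (q * ((m : ℝ) + 1) / 2) ^ 2) ''
          Set.Icc (-Real.pi) Real.pi) := by
  have hS : IsStarNormal S :=
    ⟨(Unitary.star_mul_self_of_mem hSU).trans (Unitary.mul_star_self_of_mem hSU).symm⟩
  let x : C(spectrum ℂ S, ℂ) := (ContinuousMap.id ℂ).restrict (spectrum ℂ S)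
  let f : ℕ → C(spectrum ℂ S, ℂ) := fun m => (c m : ℂ) • (2 - x ^ (m + 1) - star x ^ (m + 1))
  have hx : ∀ s : spectrum ℂ S, ‖(s : ℂ)‖ = 1 := fun s => by
    simpa using hσ.subset s.2
  have hf : Summable f := by
    refine Summable.of_norm_bounded (g := fun m => |c m| * 4) (hc.abs.mul_right 4) fun m => ?_
    refine (ContinuousMap.norm_le _ (by positivity)).mpr fun s => ?_
    have h1 : ‖(2 : ℂ) - (s : ℂ) ^ (m + 1) - star (s : ℂ) ^ (m + 1)‖ ≤ 4 := by
      refine (norm_sub_le _ _).trans ?_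
      have h2 := norm_sub_le (2 : ℂ) ((s : ℂ) ^ (m + 1))
      rw [norm_pow, hx, one_pow] at h2
      rw [norm_pow, norm_star, hx, one_pow]
      norm_num at h2 ⊢
      linarith
    have h3 : f m s = (c m : ℂ) * ((2 : ℂ) - (s : ℂ) ^ (m + 1) - star (s : ℂ) ^ (m + 1)) := rfl
    rw [h3, norm_mul, Complex.norm_real, Real.norm_eq_abs]
    gcongr
  have hval : ∀ (s : spectrum ℂ S) (q : ℝ), (s : ℂ) = Complex.exp (q * Complex.I) →
      (∑' m, f m) s
        = ((4 * ∑' m : ℕ, c m * Real.sin (q * ((m : ℝ) + 1) / 2) ^ 2 : ℝ) : ℂ) := by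
    intro s q hs
    rw [← ContinuousMap.tsum_apply hf, ← tsum_mul_left, Complex.ofReal_tsum]
    refine tsum_congr fun m => ?_
    have h3 : f m s = (c m : ℂ) * ((2 : ℂ) - (s : ℂ) ^ (m + 1)
      - (starRingEnd ℂ) (s : ℂ) ^ (m + 1)) := rfl
    have h4 : (s : ℂ) ^ (m + 1) = Complex.exp (((q * (m + 1) : ℝ) : ℂ) * Complex.I) := by
      rw [hs, ← Complex.exp_nat_mul]
      congr 1
      push_cast
      ring
    have h5 : (Real.sin (q * ((m : ℝ) + 1) / 2)) ^ 2 = 1 / 2 - Real.cos (q * (m + 1)) / 2 := by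
      rw [Real.sin_sq_eq_half_sub]
      ring_nf
    rw [h3, sub_sub, ← map_pow, Complex.add_conj, h4, Complex.exp_ofReal_mul_I_re, h5]
    push_cast
    ring
  refine ⟨cfcHom hS (∑' m, f m), ?_, ?_⟩
  · have h := hf.hasSum.map (cfcHom hS) (cfcHom_continuous hS)
    convert h using 2 with m
    have hid : cfcHom hS x = S := cfcHom_id hS
    have h2 : cfcHom hS (2 : C(spectrum ℂ S, ℂ)) = 2 := map_ofNat (cfcHom hS) 2
    simp [f, hid, h2, map_star]
  rw [cfcHom_map_spectrum]
  ext a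
  constructor
  · rintro ⟨s, rfl⟩
    refine ⟨_, ⟨Complex.arg s, ⟨(Complex.neg_pi_lt_arg _).le, Complex.arg_le_pi _⟩, rfl⟩, (hval s _ ?_).symm⟩
    have := Complex.norm_mul_exp_arg_mul_I (s : ℂ)
    rw [hx] at this
    simpa using this.symm
  · rintro ⟨_, ⟨q, -, rfl⟩, rfl⟩
    have hmem : Complex.exp (q * Complex.I) ∈ spectrum ℂ S := by
      rw [hσ]
      simp [Complex.norm_exp_ofReal_mul_I]
    exact ⟨⟨_, hmem⟩, hval _ q rfl⟩

/-- The spectrum of the bounded self-adjoint operator `−ℒ` on `ℓ²(ℤ;ℂ)`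
equals the interval `[0, M*]`, where `M* = max_{q ∈ [−π,π]} 4 ∑_{m≥1} J_m sin²(qm/2)`. -/
theorem spectrum_neg_nonlocal_operator
    (J : ℤ → ℝ) (hJnonneg : ∀ m : ℤ, 0 ≤ J m) (hJsymm : ∀ m : ℤ, J (-m) = J m)
    (hJzero : J 0 = 0) (hJsum : Summable J)
    (T : lp (fun _ : ℤ => ℂ) 2 →L[ℂ] lp (fun _ : ℤ => ℂ) 2)
    (hT : ∀ u : lp (fun _ : ℤ => ℂ) 2, ∀ n : ℤ,
      (↑(T u) : ∀ _ : ℤ, ℂ) n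
        = -(∑' m : ℤ, (J (|m - n|) : ℂ) * ((↑u : ∀ _ : ℤ, ℂ) m - (↑u : ∀ _ : ℤ, ℂ) n)))
    (Mstar : ℝ)
    (hMstar : IsGreatest
      ((fun q : ℝ => 4 * ∑' m : ℕ, J ((m : ℤ) + 1) * Real.sin (q * ((m : ℝ) + 1) / 2) ^ 2) ''
        Set.Icc (-Real.pi) Real.pi) Mstar) :
    spectrum ℂ T = Complex.ofReal '' Set.Icc (0 : ℝ) Mstar := by
  have hc : Summable fun m : ℕ => J ((m : ℤ) + 1) :=
    hJsum.comp_injective fun a b h => by simpa using h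
  set g : ℝ → ℝ :=
    fun q => 4 * ∑' m : ℕ, J ((m : ℤ) + 1) * Real.sin (q * ((m : ℝ) + 1) / 2) ^ 2 with hg
  have hJabs : ∀ m : ℤ, J |m| = J m := fun m => by
    rcases abs_choice m with h | h <;> simp [h, hJsymm]
  obtain ⟨A, hA, hspec⟩ := exists_hasSum_unitary_spectrum_eq bilateralShift.2
    spectrum_bilateralShift hc
  have hTA : T = A := by
    ext u n
    have hev := (hA.mapL (ContinuousLinearMap.apply ℂ _ u)).mapL
      (lp.evalCLM ℂ (fun _ : ℤ => ℂ) 2 n)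
    have hcoord : HasSum (fun m : ℕ =>
        (J ((m : ℤ) + 1) : ℂ) * (2 * u n - u (n + (m + 1)) - u (n - (m + 1)))) (A u n) := by
      refine Eq.mp (congrArg (fun f => HasSum f (A u n)) (funext fun m => ?_)) hev
      rw [← one_add_one_eq_two (R := lp (fun _ : ℤ => ℂ) 2 →L[ℂ] lp (fun _ : ℤ => ℂ) 2)]
      refine (congrArg₂ (fun a b => (J ((m : ℤ) + 1) : ℂ) * (u n + u n - a - b))
        (bilateralShift_pow_apply (m + 1) u n) (star_bilateralShift_pow_apply (m + 1) u n)).trans ?_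
      push_cast
      ring
    have hsum : ∀ e : ℕ → ℤ, Summable fun m : ℕ =>
        (J ((m : ℤ) + 1) : ℂ) * (u (e m) - u n) := fun e => by
      refine Summable.of_norm_bounded (hc.mul_right (‖u‖ + ‖u‖)) fun m => ?_
      rw [norm_mul, Complex.norm_real, Real.norm_of_nonneg (hJnonneg _)]
      gcongr
      · exact hJnonneg _
      · exact (norm_sub_le _ _).trans (add_le_add (lp.norm_apply_le_norm (by norm_num) u _)
          (lp.norm_apply_le_norm (by norm_num) u _))
    have hpos := hsum fun m => n + (m + 1)
    have hneg := hsum fun m => n - (m + 1)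
    have hsplit := tsum_of_add_one_of_neg_add_one
      (f := fun k : ℤ => (J k : ℂ) * (u (n + k) - u n)) hpos
      (by simpa only [hJsymm, ← sub_eq_add_neg] using hneg)
    simp only [hJsymm, ← sub_eq_add_neg, hJzero, Complex.ofReal_zero, zero_mul, add_zero] at hsplit
    rw [hT, ← (Equiv.addLeft n).tsum_eq]
    simp only [Equiv.coe_addLeft, add_sub_cancel_left, hJabs]
    rw [hsplit, ← hpos.tsum_add hneg, ← tsum_neg, ← hcoord.tsum_eq]
    refine tsum_congr fun m => ?_
    ring
  have hgc : Continuous g := by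
    refine continuous_const.mul (continuous_tsum (fun m => by fun_prop) hc fun m q => ?_)
    rw [norm_mul, Real.norm_of_nonneg (hJnonneg _), norm_pow, Real.norm_eq_abs, sq_abs]
    exact mul_le_of_le_one_right (hJnonneg _) (Real.sin_sq_le_one _)
  have hg0 : ∀ q, 0 ≤ g q := fun q =>
    mul_nonneg (by norm_num) (tsum_nonneg fun m => mul_nonneg (hJnonneg _) (sq_nonneg _))
  rw [hTA, hspec]
  congr 1
  refine Set.Subset.antisymm ?_ ?_
  · rintro _ ⟨q, hq, rfl⟩
    exact ⟨hg0 q, hMstar.2 ⟨q, hq, rfl⟩⟩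
  · refine (isPreconnected_Icc.image g hgc.continuousOn).Icc_subset ⟨0, ?_, by simp [hg]⟩ hMstar.1
    exact ⟨by linarith [Real.pi_pos], Real.pi_pos.le⟩
end

section
/- Let s > 0 and set p = min(1, s). There exists a constant C > 0 (depending on s) such that for all q ∈ [−π, π], ∑_{m=1}^∞ 4 sin²(qm/2) / m^{1+2s} ≥ C |q|^{2p}. -/
open scoped BigOperators

lemma summable_dispersion_symbol (s : ℝ) (hs : 0 < s) (q : ℝ) :
    Summable fun m : ℕ =>
      4 * Real.sin (q * ((m : ℝ) + 1) / 2) ^ 2 / ((m : ℝ) + 1) ^ (1 + 2 * s) := by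
  have h : Summable fun m : ℕ => 4 * (1 / ((m : ℝ) + 1) ^ (1 + 2 * s)) := by
    have h₀ := (summable_nat_add_iff 1).2
      (Real.summable_one_div_nat_rpow.2 (by linarith : 1 < 1 + 2 * s))
    simpa using h₀.mul_left 4
  refine Summable.of_nonneg_of_le (fun m => by positivity) (fun m => ?_) h
  rw [← mul_div_assoc, mul_one]
  gcongr
  linarith [Real.sin_sq_le_one (q * ((m : ℝ) + 1) / 2)]

lemma sq_le_sin_half_sq {y : ℝ} (h₀ : 0 ≤ y) (h₁ : y ≤ Real.pi) :
    (y / Real.pi) ^ 2 ≤ Real.sin (y / 2) ^ 2 := by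
  have h := Real.mul_le_sin (x := y / 2) (by linarith) (by linarith)
  rw [show 2 / Real.pi * (y / 2) = y / Real.pi by ring] at h
  have := Real.pi_pos
  gcongr

lemma cube_div_three_le_sum_sq (N : ℕ) :
    (N : ℝ) ^ 3 / 3 ≤ ∑ i ∈ Finset.range N, ((i : ℝ) + 1) ^ 2 := by
  induction N with
  | zero => simp
  | succ n ih =>
    rw [Finset.sum_range_succ]
    push_cast
    nlinarith [(Nat.cast_nonneg n : (0 : ℝ) ≤ n)]

/-- The terms with `m ≤ N` bound the symbol from below as long as `N |q| ≤ π`. -/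
lemma truncated_bound_le_dispersion_symbol (s : ℝ) (hs : 0 < s) (q : ℝ) (N : ℕ) (hN : 1 ≤ N)
    (hq : N * |q| ≤ Real.pi) :
    4 / (3 * Real.pi ^ 2) * |q| ^ 2 * (N : ℝ) ^ (2 - 2 * s)
      ≤ ∑' m : ℕ, 4 * Real.sin (q * ((m : ℝ) + 1) / 2) ^ 2 / ((m : ℝ) + 1) ^ (1 + 2 * s) := by
  have hN' : (0 : ℝ) < N := by exact_mod_cast hN
  have hpi := Real.pi_pos
  refine le_trans ?_ ((summable_dispersion_symbol s hs q).sum_le_tsum (Finset.range N)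
    (fun m _ => by positivity))
  have hterm : ∀ i ∈ Finset.range N,
      4 * |q| ^ 2 / Real.pi ^ 2 / (N : ℝ) ^ (1 + 2 * s) * ((i : ℝ) + 1) ^ 2
        ≤ 4 * Real.sin (q * ((i : ℝ) + 1) / 2) ^ 2 / ((i : ℝ) + 1) ^ (1 + 2 * s) := by
    intro i hi
    have hiN : (i : ℝ) + 1 ≤ N := by exact_mod_cast Finset.mem_range.1 hi
    have hsin : Real.sin (q * ((i : ℝ) + 1) / 2) ^ 2
        = Real.sin (|q| * ((i : ℝ) + 1) / 2) ^ 2 := by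
      rcases abs_choice q with h | h <;> rw [h]
      rw [neg_mul, neg_div, Real.sin_neg, neg_sq]
    have hle : |q| * ((i : ℝ) + 1) ≤ Real.pi := by
      nlinarith [abs_nonneg q]
    calc 4 * |q| ^ 2 / Real.pi ^ 2 / (N : ℝ) ^ (1 + 2 * s) * ((i : ℝ) + 1) ^ 2
        = 4 * (|q| * ((i : ℝ) + 1) / Real.pi) ^ 2 / (N : ℝ) ^ (1 + 2 * s) := by ring
      _ ≤ _ := by
        rw [hsin]
        gcongr 4 * ?_ / ?_ ^ (1 + 2 * s)
        exact sq_le_sin_half_sq (by positivity) hle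
  refine le_trans ?_ (Finset.sum_le_sum hterm)
  rw [← Finset.mul_sum]
  have hpow : (N : ℝ) ^ (2 - 2 * s) = (N : ℝ) ^ 3 / (N : ℝ) ^ (1 + 2 * s) := by
    rw [← Real.rpow_natCast, ← Real.rpow_sub hN']
    congr 1
    push_cast
    ring
  calc 4 / (3 * Real.pi ^ 2) * |q| ^ 2 * (N : ℝ) ^ (2 - 2 * s)
      = 4 * |q| ^ 2 / Real.pi ^ 2 / (N : ℝ) ^ (1 + 2 * s) * ((N : ℝ) ^ 3 / 3) := by
        rw [hpow]; field_simp
    _ ≤ _ := by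
        gcongr
        exact cube_div_three_le_sum_sq N

/-- For `s > 0` and `p = min(1,s)`, there is `C > 0` such that for all
`q ∈ [−π,π]`, `∑_{m≥1} 4 sin²(qm/2)/m^{1+2s} ≥ C |q|^{2p}`. -/
theorem dispersion_symbol_lower_bound (s : ℝ) (hs : 0 < s) :
    ∃ C : ℝ, 0 < C ∧
      ∀ q ∈ Set.Icc (-Real.pi) Real.pi,
        C * |q| ^ (2 * min 1 s)
          ≤ ∑' m : ℕ, 4 * Real.sin (q * ((m : ℝ) + 1) / 2) ^ 2 / ((m : ℝ) + 1) ^ (1 + 2 * s) := by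
  have hpi := Real.pi_pos
  refine ⟨4 / (3 * Real.pi ^ 2), by positivity, fun q hq => ?_⟩
  have hq' : |q| ≤ Real.pi := abs_le.2 hq
  rcases le_total 1 s with h1 | h1
  · have h := truncated_bound_le_dispersion_symbol s hs q 1 le_rfl (by simpa using hq')
    rw [min_eq_left h1, mul_one, Real.rpow_two]
    simpa using h
  rw [min_eq_right h1]
  rcases (abs_nonneg q).eq_or_lt with h0 | h0
  · rw [← h0, Real.zero_rpow (by positivity), mul_zero]
    exact tsum_nonneg fun m => by positivity
  set N := ⌊Real.pi / |q|⌋₊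
  have hN : 1 ≤ N := Nat.le_floor (by rw [Nat.cast_one, one_le_div h0]; exact hq')
  have hNq : N * |q| ≤ Real.pi := (le_div_iff₀ h0).1 (Nat.floor_le (by positivity))
  have hlow : |q|⁻¹ ≤ N := by
    have hlt : Real.pi < (N + 1) * |q| := (div_lt_iff₀ h0).1 (Nat.lt_floor_add_one _)
    have hN1 : (1 : ℝ) ≤ N := by exact_mod_cast hN
    rw [inv_le_iff_one_le_mul₀ h0]
    nlinarith [Real.pi_gt_three]
  refine le_trans ?_ (truncated_bound_le_dispersion_symbol s hs q N hN hNq)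
  have hsplit : |q| ^ (2 * s) = |q| ^ 2 * |q|⁻¹ ^ (2 - 2 * s) := by
    rw [Real.inv_rpow h0.le, ← Real.rpow_neg h0.le, ← Real.rpow_two, ← Real.rpow_add h0]
    congr 1
    ring
  rw [hsplit, mul_assoc]
  gcongr
  linarith
end

section
/- Let s > 0 be a real number such that 2s is not an integer. Then for every real q with |q| ≤ π, ∑_{m=1}^∞ 4 sin²(qm/2)/m^{1+2s} = −2 Γ(−2s) cos(πs) |q|^{2s} + 2 ∑_{j=1}^∞ (−1)^{j+1} ζ(1+2s−2j) q^{2j}/(2j)!, where Γ is the Gamma function, ζ is the analytically continued Riemann zeta function (whose values at the real points 1+2s−2j, which are never 1, are real), and the series on the right-hand side converges absolutely. -/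
open scoped BigOperators

open Complex HurwitzZeta Set Filter Topology
open scoped Nat Real

/-- The coefficient `(z)ₙ / n!` of `xⁿ` in the binomial series of `(1 - x)⁻ᶻ`. -/
noncomputable def risingCoeff (z : ℂ) (n : ℕ) : ℂ := (ascPochhammer ℂ n).eval z / n !

lemma hasSum_risingCoeff (z : ℂ) {x : ℂ} (hx : ‖x‖ < 1) :
    HasSum (fun n ↦ risingCoeff z n * x ^ n) (1 / (1 - x) ^ z) := by
  have h := (one_div_one_sub_cpow_hasFPowerSeriesOnBall_zero z).hasSum (y := x)
    (by rwa [Metric.mem_eball, edist_zero_right, ← ofReal_norm, ENNReal.ofReal_lt_one])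
  simp only [zero_add] at h
  refine h.congr_fun fun n ↦ ?_
  have hc : Ring.choose (z + n - 1) n = risingCoeff z n := by
    have := Ring.factorial_nsmul_multichoose_eq_ascPochhammer z n
    rw [Polynomial.ascPochhammer_smeval_eq_eval] at this
    rw [risingCoeff, ← this, Ring.choose, nsmul_eq_mul,
      mul_div_cancel_left₀ _ (by exact_mod_cast n.factorial_ne_zero)]
    congr 1
    ring
  simp [FormalMultilinearSeries.ofScalars, hc]

lemma norm_risingCoeff_le {z : ℂ} {K : ℕ} (hz : ‖z‖ ≤ K + 1) (n : ℕ) :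
    ‖risingCoeff z n‖ ≤ (n + K).choose K := by
  have h : ‖(ascPochhammer ℂ n).eval z‖ ≤ ((K + 1).ascFactorial n : ℕ) := by
    induction n with
    | zero => simp
    | succ n ih =>
      rw [ascPochhammer_succ_eval, norm_mul, Nat.ascFactorial_succ, mul_comm]
      push_cast
      gcongr
      calc ‖z + n‖ ≤ ‖z‖ + ‖(n : ℂ)‖ := norm_add_le _ _
        _ ≤ K + 1 + n := by rw [norm_natCast]; gcongr
  rw [risingCoeff, norm_div, norm_natCast, div_le_iff₀ (by positivity)]
  refine h.trans_eq ?_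
  rw [Nat.ascFactorial_eq_factorial_mul_choose, add_comm n K, ← Nat.choose_symm_add]
  push_cast
  ring

lemma summable_choose_mul_pow_two_mul (K : ℕ) {r : ℝ} (hr : ‖r‖ < 1) :
    Summable fun j : ℕ ↦ ((2 * j + K).choose K : ℝ) * r ^ (2 * j) :=
  (summable_choose_mul_geometric_of_norm_lt_one K hr).comp_injective
    (mul_right_injective₀ (two_ne_zero' ℕ))

lemma hasSum_risingCoeff_two_mul (z : ℂ) {x : ℂ} (hx : ‖x‖ < 1) :
    HasSum (fun j ↦ 2 * (risingCoeff z (2 * j) * x ^ (2 * j)))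
      (1 / (1 - x) ^ z + 1 / (1 + x) ^ z) := by
  have h := (hasSum_risingCoeff z hx).add (hasSum_risingCoeff z (x := -x) (by simpa using hx))
  rw [sub_neg_eq_add, ← (mul_right_injective₀ (two_ne_zero' ℕ)).hasSum_iff] at h
  · refine h.congr_fun fun j ↦ ?_
    simp only [Function.comp_apply, even_two_mul, Even.neg_pow]
    ring
  · intro n hn
    have : Odd n := by
      rw [← Nat.not_even_iff_odd]
      rintro ⟨k, rfl⟩
      exact hn ⟨k, two_mul k⟩
    rw [this.neg_pow]
    ring

lemma norm_riemannZeta_le_of_two_le_re {z : ℂ} (hz : 2 ≤ z.re) :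
    ‖riemannZeta z‖ ≤ ∑' n : ℕ, 1 / ((n : ℝ) + 1) ^ 2 := by
  have hs : Summable fun n : ℕ ↦ 1 / ((n : ℝ) + 1) ^ 2 := by
    exact_mod_cast (summable_nat_add_iff 1).mpr (Real.summable_one_div_nat_pow.mpr one_lt_two)
  rw [zeta_eq_tsum_one_div_nat_add_one_cpow (by linarith)]
  refine tsum_of_norm_bounded hs.hasSum fun n ↦ ?_
  have : ((n : ℂ) + 1) = ((n + 1 : ℝ) : ℂ) := by push_cast; rfl
  rw [norm_div, norm_one, this, norm_cpow_eq_rpow_re_of_pos (by positivity), ← Real.rpow_natCast]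
  gcongr
  · linarith [n.cast_nonneg (α := ℝ)]
  · exact_mod_cast hz

lemma hasSum_hurwitzZetaEven_expansion {a : ℝ} (ha : 0 < a) (ha1 : a < 1) {z : ℂ}
    (hz : 1 < z.re) :
    HasSum (fun j : ℕ ↦ risingCoeff z (2 * j) * a ^ (2 * j) * riemannZeta (z + 2 * j))
      (hurwitzZetaEven a z - 1 / (a : ℂ) ^ z / 2) := by
  set F : ℕ × ℕ → ℂ := fun p ↦
    risingCoeff z (2 * p.2) * a ^ (2 * p.2) * (1 / ((p.1 : ℂ) + 1) ^ (z + 2 * p.2)) with hF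
  have hre (j : ℕ) : (z + 2 * j).re = z.re + 2 * j := by simp
  have hsum : Summable F := by
    obtain ⟨K, hK⟩ := exists_nat_ge ‖z‖
    have h1 : Summable fun n : ℕ ↦ 1 / ((n : ℝ) + 1) ^ z.re := by
      exact_mod_cast (summable_nat_add_iff 1).mpr (Real.summable_one_div_nat_rpow.mpr hz)
    have h2 := summable_choose_mul_pow_two_mul K (r := a) (by rwa [Real.norm_of_nonneg ha.le])
    refine Summable.of_norm_bounded
      (h1.mul_of_nonneg h2 (fun _ ↦ by positivity) fun _ ↦ by positivity) fun ⟨n, j⟩ ↦ ?_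
    have hn : ((n : ℂ) + 1) = ((n + 1 : ℝ) : ℂ) := by push_cast; rfl
    simp only [hF, norm_mul, norm_div, norm_one, norm_pow, norm_real, Real.norm_of_nonneg ha.le]
    rw [hn, norm_cpow_eq_rpow_re_of_pos (by positivity), hre, mul_comm]
    gcongr
    · linarith [n.cast_nonneg (α := ℝ)]
    · linarith [j.cast_nonneg (α := ℝ)]
    · exact norm_risingCoeff_le (hK.trans (by simp)) _
  have hrow (n : ℕ) : HasSum (fun j ↦ F (n, j))
      (1 / (↑|((n + 1 : ℕ) : ℝ) + a| : ℂ) ^ z / 2 + 1 / (↑|-((n + 1 : ℕ) : ℝ) + a| : ℂ) ^ z / 2) := by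
    have hn : (0 : ℝ) < n + 1 := by positivity
    have hn' : ((n : ℂ) + 1) ≠ 0 := n.cast_add_one_ne_zero
    have hlt : a / (n + 1) < 1 := (div_lt_one hn).mpr (by linarith [n.cast_nonneg (α := ℝ)])
    have hx : ‖((a / (n + 1) : ℝ) : ℂ)‖ < 1 := by
      rwa [norm_real, Real.norm_of_nonneg (by positivity)]
    have h := (hasSum_risingCoeff_two_mul z hx).mul_left (1 / ((n : ℂ) + 1) ^ z / 2)
    have hadd : (↑|((n + 1 : ℕ) : ℝ) + a| : ℂ) ^ z =
        ((n : ℂ) + 1) ^ z * (1 + ((a / (n + 1) : ℝ) : ℂ)) ^ z := by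
      have := mul_cpow_ofReal_nonneg hn.le (b := 1 + a / (n + 1)) (by positivity) z
      push_cast at this ⊢
      rw [← this, abs_of_pos (by positivity)]
      congr 1
      push_cast
      field_simp
    have hsub : (↑|-((n + 1 : ℕ) : ℝ) + a| : ℂ) ^ z =
        ((n : ℂ) + 1) ^ z * (1 - ((a / (n + 1) : ℝ) : ℂ)) ^ z := by
      have := mul_cpow_ofReal_nonneg hn.le (b := 1 - a / (n + 1)) (by linarith) z
      push_cast at this ⊢
      rw [← this, abs_of_neg (by linarith [n.cast_nonneg (α := ℝ)])]
      congr 1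
      push_cast
      field_simp
      ring
    rw [hadd, hsub]
    have hval : 1 / (((n : ℂ) + 1) ^ z * (1 + ((a / (n + 1) : ℝ) : ℂ)) ^ z) / 2 +
        1 / (((n : ℂ) + 1) ^ z * (1 - ((a / (n + 1) : ℝ) : ℂ)) ^ z) / 2 =
        1 / ((n : ℂ) + 1) ^ z / 2 * (1 / (1 - ((a / (n + 1) : ℝ) : ℂ)) ^ z +
          1 / (1 + ((a / (n + 1) : ℝ) : ℂ)) ^ z) := by
      simp only [one_div, mul_inv]
      ring
    rw [hval]
    refine h.congr_fun fun j ↦ ?_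
    have h2 : ((n : ℂ) + 1) ^ (2 * (j : ℂ)) = ((n : ℂ) + 1) ^ (2 * j) := by
      exact_mod_cast cpow_natCast ((n : ℂ) + 1) (2 * j)
    simp only [hF, cpow_add _ _ hn', h2]
    push_cast
    rw [div_pow]
    field_simp
  have hcol (j : ℕ) : HasSum (fun n ↦ F (n, j))
      (risingCoeff z (2 * j) * a ^ (2 * j) * riemannZeta (z + 2 * j)) := by
    have hj : 1 < (z + 2 * j).re := by rw [hre]; linarith [j.cast_nonneg (α := ℝ)]
    rw [zeta_eq_tsum_one_div_nat_add_one_cpow hj, ← tsum_mul_left]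
    exact (hsum.comp_injective (Prod.mk_left_injective j)).hasSum
  have hint := (hasSum_int_hurwitzZetaEven a hz).nat_add_neg
  rw [← hasSum_nat_add_iff' 1] at hint
  have htot := hsum.hasSum.prod_fiberwise hrow
  have heq := htot.unique (hint.congr_fun fun n ↦ by push_cast; rfl)
  have hres := ((Equiv.prodComm ℕ ℕ).hasSum_iff.mpr hsum.hasSum).prod_fiberwise hcol
  rw [heq] at hres
  convert hres using 1
  simp [abs_of_pos ha]
  ring

lemma differentiable_risingCoeff (n : ℕ) : Differentiable ℂ fun z ↦ risingCoeff z n :=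
  (ascPochhammer ℂ n).differentiable.div_const _

lemma differentiableAt_expansion_term (a : ℝ) {z : ℂ} (j : ℕ) (hz : z + 2 * j ≠ 1) :
    DifferentiableAt ℂ
      (fun z ↦ risingCoeff z (2 * j) * a ^ (2 * j) * riemannZeta (z + 2 * j)) z :=
  ((differentiable_risingCoeff _ z).mul_const _).mul
    ((differentiableAt_riemannZeta hz).comp (f := fun z : ℂ ↦ z + 2 * (j : ℂ)) z
      (differentiableAt_id.add_const _))

lemma exists_summable_bound_expansion_tail {a : ℝ} (ha : 0 < a) (ha1 : a < 1) (K : ℕ) :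
    ∃ u : ℕ → ℝ, Summable u ∧ ∀ (j : ℕ) (z : ℂ), ‖z‖ ≤ K →
      ‖risingCoeff z (2 * (j + (K + 2))) * a ^ (2 * (j + (K + 2))) *
        riemannZeta (z + 2 * ((j + (K + 2) : ℕ) : ℂ))‖ ≤ u j := by
  set C := ∑' n : ℕ, 1 / ((n : ℝ) + 1) ^ 2
  have h := summable_choose_mul_pow_two_mul K (r := a) (by rwa [Real.norm_of_nonneg ha.le])
  refine ⟨_, ((summable_nat_add_iff (K + 2)).mpr h).mul_right C, fun j z hz ↦ ?_⟩
  rw [norm_mul, norm_mul, norm_pow, norm_real, Real.norm_of_nonneg ha.le]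
  gcongr
  · exact norm_risingCoeff_le (by linarith) _
  · refine norm_riemannZeta_le_of_two_le_re ?_
    have h1 := (abs_le.mp ((abs_re_le_norm z).trans hz)).1
    have h2 : (z + 2 * ((j + (K + 2) : ℕ) : ℂ)).re = z.re + 2 * (j + (K + 2) : ℕ) := by simp
    rw [h2]
    push_cast
    linarith [j.cast_nonneg (α := ℝ), K.cast_nonneg (α := ℝ)]

lemma summable_expansion {a : ℝ} (ha : 0 < a) (ha1 : a < 1) (z : ℂ) :
    Summable fun j : ℕ ↦ risingCoeff z (2 * j) * a ^ (2 * j) * riemannZeta (z + 2 * j) := by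
  obtain ⟨K, hK⟩ := exists_nat_ge ‖z‖
  obtain ⟨u, hu, hb⟩ := exists_summable_bound_expansion_tail ha ha1 K
  rw [← summable_nat_add_iff (K + 2)]
  exact .of_norm_bounded hu fun j ↦ hb j z hK

lemma add_two_mul_ne_one {z : ℂ} (hz : z ∈ integerComplement) (j : ℕ) : z + 2 * j ≠ 1 := by
  intro h
  refine hz ⟨1 - 2 * j, ?_⟩
  push_cast
  rw [← h]
  ring

lemma isOpen_integerComplement : IsOpen integerComplement :=
  isOpen_compl_range_intCast

lemma differentiableOn_tsum_expansion {a : ℝ} (ha : 0 < a) (ha1 : a < 1) :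
    DifferentiableOn ℂ
      (fun z ↦ ∑' j : ℕ, risingCoeff z (2 * j) * a ^ (2 * j) * riemannZeta (z + 2 * j))
      integerComplement := by
  intro z hz
  obtain ⟨K, hK⟩ := exists_nat_gt ‖z‖
  obtain ⟨u, hu, hb⟩ := exists_summable_bound_expansion_tail ha ha1 K
  have hV : IsOpen (integerComplement ∩ Metric.ball (0 : ℂ) K) :=
    isOpen_integerComplement.inter Metric.isOpen_ball
  have hmem : integerComplement ∩ Metric.ball (0 : ℂ) K ∈ 𝓝 z :=
    hV.mem_nhds ⟨hz, by simpa using hK⟩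
  have htail := (differentiableOn_tsum_of_summable_norm hu
    (fun j w hw ↦ (differentiableAt_expansion_term a (j + (K + 2))
      (add_two_mul_ne_one hw.1 _)).differentiableWithinAt) hV
    fun j w hw ↦ hb j w (mem_ball_zero_iff.mp hw.2).le).differentiableAt hmem
  have hhead : DifferentiableAt ℂ (fun w ↦ ∑ j ∈ Finset.range (K + 2),
      risingCoeff w (2 * j) * a ^ (2 * j) * riemannZeta (w + 2 * j)) z :=
    .fun_sum fun j _ ↦ differentiableAt_expansion_term a j (add_two_mul_ne_one hz j)
  refine ((hhead.add htail).congr_of_eventuallyEq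
    (.of_forall fun w ↦ ?_)).differentiableWithinAt
  exact ((summable_expansion ha ha1 w).sum_add_tsum_nat_add (K + 2)).symm

lemma isPreconnected_integerComplement : IsPreconnected integerComplement :=
  ((countable_range _).isPathConnected_compl_of_one_lt_rank
    (by rw [rank_real_complex]; exact Cardinal.one_lt_two)).isConnected.isPreconnected

/-- Taylor expansion in `a` of the even Hurwitz zeta function with its singular term removed. -/
lemma hasSum_hurwitzZetaEven_expansion_of_mem_integerComplement {a : ℝ} (ha : 0 < a)
    (ha1 : a < 1) {z : ℂ} (hz : z ∈ integerComplement) :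
    HasSum (fun j : ℕ ↦ risingCoeff z (2 * j) * a ^ (2 * j) * riemannZeta (z + 2 * j))
      (hurwitzZetaEven a z - 1 / (a : ℂ) ^ z / 2) := by
  have ha0 : (a : ℂ) ≠ 0 := by exact_mod_cast ha.ne'
  have hdiff : DifferentiableOn ℂ (fun z ↦ hurwitzZetaEven a z - 1 / (a : ℂ) ^ z / 2)
      integerComplement := fun w hw ↦
    ((differentiableAt_hurwitzZetaEven _ (integerComplement.ne_one hw)).sub
      (((differentiableAt_const _).div (differentiableAt_id.const_cpow (.inl ha0))
        (by simp [cpow_eq_zero_iff, ha0])).div_const _)).differentiableWithinAt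
  have hmem : (3 / 2 : ℂ) ∈ integerComplement := by
    rintro ⟨n, hn⟩
    have : (2 * n : ℤ) = 3 := by
      have : (2 * n : ℂ) = 3 := by rw [hn]; norm_num
      exact_mod_cast this
    omega
  have heq := (differentiableOn_tsum_expansion ha ha1).analyticOnNhd isOpen_integerComplement
    |>.eqOn_of_preconnected_of_eventuallyEq (hdiff.analyticOnNhd isOpen_integerComplement)
      isPreconnected_integerComplement hmem (by
        filter_upwards [(isOpen_lt continuous_const continuous_re).mem_nhds
          (show (1 : ℝ) < (3 / 2 : ℂ).re by norm_num)] with w hw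
        exact (hasSum_hurwitzZetaEven_expansion ha ha1 hw).tsum_eq)
  have hval : _ = hurwitzZetaEven a z - 1 / (a : ℂ) ^ z / 2 := heq hz
  rw [← hval]
  exact (summable_expansion ha ha1 z).hasSum

lemma Gamma_add_nat_eq_ascPochhammer_mul {z : ℂ} (hz : z ∈ integerComplement) (n : ℕ) :
    Gamma (z + n) = (ascPochhammer ℂ n).eval z * Gamma z := by
  have hz' (k : ℕ) : z ≠ -k := fun h ↦ hz ⟨-k, by simp [h]⟩
  rw [← Gamma_add_nat_div_Gamma_eq z hz', div_mul_cancel₀ _ (Gamma_ne_zero hz')]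

/-- The expansion of the periodic cosine zeta function around `q = 0`. -/
lemma hasSum_cosZeta_expansion {q : ℝ} (hq : 0 < q) (hq1 : q < 2 * π) {z : ℂ}
    (hz : z ∈ integerComplement) :
    HasSum (fun j : ℕ ↦ (-1) ^ j * riemannZeta (1 - z - 2 * j) * q ^ (2 * j) / (2 * j)!)
      (cosZeta (q / (2 * π) : ℝ) (1 - z) - Gamma z * cos (π * z / 2) * (q : ℂ) ^ (-z)) := by
  have hπ : (0 : ℝ) < 2 * π := by positivity
  have hπ0 : (2 * π : ℂ) ≠ 0 := by exact_mod_cast hπ.ne'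
  have hs (n : ℕ) : z ≠ 1 - n := fun h ↦ hz ⟨1 - n, by simp [h]⟩
  have h := (hasSum_hurwitzZetaEven_expansion_of_mem_integerComplement (div_pos hq hπ)
    ((div_lt_one hπ).mpr hq1) hz).mul_left (2 * (2 * π) ^ (-z) * Gamma z * cos (π * z / 2))
  rw [mul_sub, ← cosZeta_one_sub _ hs] at h
  have hval : 2 * (2 * π) ^ (-z) * Gamma z * cos (π * z / 2) *
      (1 / ((q / (2 * π) : ℝ) : ℂ) ^ z / 2) = Gamma z * cos (π * z / 2) * (q : ℂ) ^ (-z) := by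
    have hdiv := div_cpow_ofReal_nonneg hq.le hπ.le z
    push_cast at hdiv ⊢
    have hne : (2 * π : ℂ) ^ z ≠ 0 := by simp [cpow_eq_zero_iff, hπ0]
    rw [hdiv, cpow_neg, cpow_neg]
    field_simp
  rw [hval] at h
  refine h.congr_fun fun j ↦ ?_
  have hz1 (n : ℕ) : z + (2 * j : ℕ) ≠ -n := fun h ↦
    hz ⟨-n - (2 * j : ℕ), by push_cast at h ⊢; rw [← h]; ring⟩
  have hzeta := riemannZeta_one_sub hz1 (by push_cast; exact add_two_mul_ne_one hz j)
  have hcos : cos (π * (z + (2 * j : ℕ)) / 2) = (-1) ^ j * cos (π * z / 2) := by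
    rw [← cos_antiperiodic.add_nat_mul_eq]
    congr 1
    push_cast
    ring
  rw [Gamma_add_nat_eq_ascPochhammer_mul hz, hcos, neg_add, cpow_add _ _ hπ0,
    cpow_neg _ ((2 * j : ℕ) : ℂ), cpow_natCast] at hzeta
  push_cast at hzeta ⊢
  rw [sub_sub, hzeta, risingCoeff, div_pow]
  have h1 : ((-1 : ℂ) ^ j) * (-1) ^ j = 1 := by rw [← mul_pow]; simp
  linear_combination (2 * (2 * π : ℂ) ^ (-z) * (ascPochhammer ℂ (2 * j)).eval z * Gamma z *
    cos (π * z / 2) * riemannZeta (z + 2 * j) * q ^ (2 * j) / (2 * π : ℂ) ^ (2 * j) / (2 * j)!) * h1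

lemma hasSum_re_expansion {s : ℝ} (hns : ∀ n : ℤ, 2 * s ≠ (n : ℝ)) {q : ℝ} (hq : 0 < q)
    (hq1 : q < 2 * π) :
    HasSum (fun j : ℕ ↦ (-1 : ℝ) ^ j * (riemannZeta ((1 + 2 * s - 2 * (j : ℝ) : ℝ) : ℂ)).re *
        q ^ (2 * j) / ((2 * j)! : ℝ))
      ((cosZeta (q / (2 * π) : ℝ) ((1 + 2 * s : ℝ) : ℂ)).re -
        Real.Gamma (-(2 * s)) * Real.cos (π * s) * q ^ (2 * s)) := by
  have hz : ((-(2 * s) : ℝ) : ℂ) ∈ integerComplement := by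
    rintro ⟨n, hn⟩
    have : (n : ℝ) = -(2 * s) := by exact_mod_cast hn
    exact hns (-n) (by push_cast; linarith)
  have h := hasSum_re (hasSum_cosZeta_expansion hq hq1 hz)
  have hval : Gamma ((-(2 * s) : ℝ) : ℂ) * cos (π * ((-(2 * s) : ℝ) : ℂ) / 2) *
      (q : ℂ) ^ (-((-(2 * s) : ℝ) : ℂ)) =
      ((Real.Gamma (-(2 * s)) * Real.cos (π * s) * q ^ (2 * s) : ℝ) : ℂ) := by
    have hcos : (π * ((-(2 * s) : ℝ) : ℂ) / 2) = -((π * s : ℝ) : ℂ) := by push_cast; ring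
    have hpow : -((-(2 * s) : ℝ) : ℂ) = ((2 * s : ℝ) : ℂ) := by push_cast; ring
    rw [hcos, hpow, cos_neg, Gamma_ofReal, ← ofReal_cos, ← ofReal_cpow hq.le, ← ofReal_mul,
      ← ofReal_mul]
  have h1 : 1 - ((-(2 * s) : ℝ) : ℂ) = ((1 + 2 * s : ℝ) : ℂ) := by push_cast; ring
  rw [hval, sub_re, ofReal_re, h1] at h
  refine h.congr_fun fun j ↦ ?_
  have hterm : (-1) ^ j * riemannZeta (((1 + 2 * s : ℝ) : ℂ) - 2 * j) * q ^ (2 * j) / (2 * j)! =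
      (((-1) ^ j * q ^ (2 * j) / (2 * j)! : ℝ) : ℂ) *
        riemannZeta ((1 + 2 * s - 2 * (j : ℝ) : ℝ) : ℂ) := by
    push_cast
    ring
  rw [hterm, re_ofReal_mul]
  ring

lemma hasSum_re_cosZeta (a : ℝ) {x : ℝ} (hx : 1 < x) :
    HasSum (fun m : ℕ ↦ Real.cos (2 * π * a * ((m : ℝ) + 1)) / ((m : ℝ) + 1) ^ x)
      (cosZeta a (x : ℂ)).re := by
  have h := hasSum_re (hasSum_nat_cosZeta a (s := (x : ℂ)) (by simpa using hx))
  rw [← hasSum_nat_add_iff' 1] at h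
  have h0 : (x : ℂ) ≠ 0 := by exact_mod_cast (zero_lt_one.trans hx).ne'
  simp only [Finset.sum_range_one, Nat.cast_zero, zero_cpow h0, div_zero, zero_re, sub_zero] at h
  refine h.congr_fun fun m ↦ ?_
  rw [← ofReal_natCast, ← ofReal_cpow (by positivity), ← ofReal_div, ofReal_re]
  push_cast
  rfl

lemma hasSum_four_mul_sin_sq {x : ℝ} (hx : 1 < x) (q : ℝ) :
    HasSum (fun m : ℕ ↦ 4 * Real.sin (q * ((m : ℝ) + 1) / 2) ^ 2 / ((m : ℝ) + 1) ^ x)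
      (2 * (riemannZeta x).re - 2 * (cosZeta (q / (2 * π) : ℝ) (x : ℂ)).re) := by
  have h0 := hasSum_re_cosZeta 0 hx
  rw [QuotientAddGroup.mk_zero, cosZeta_zero] at h0
  refine ((h0.mul_left 2).sub ((hasSum_re_cosZeta (q / (2 * π)) hx).mul_left 2)).congr_fun
    fun m ↦ ?_
  have hq : 2 * π * (q / (2 * π)) * ((m : ℝ) + 1) = 2 * (q * ((m : ℝ) + 1) / 2) := by
    field_simp
  rw [hq, Real.sin_sq_eq_half_sub]
  simp only [mul_zero, zero_mul, Real.cos_zero]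
  ring

/-- For `s > 0` with `2s` not an integer and `|q| ≤ π`,
`∑_{m≥1} 4 sin²(qm/2)/m^{1+2s}
  = −2 Γ(−2s) cos(πs) |q|^{2s} + 2 ∑_{j≥1} (−1)^{j+1} ζ(1+2s−2j) q^{2j}/(2j)!`,
the series on the right converging absolutely. -/
theorem dispersion_symbol_expansion (s : ℝ) (hs : 0 < s)
    (hns : ∀ n : ℤ, 2 * s ≠ (n : ℝ)) (q : ℝ) (hq : |q| ≤ Real.pi) :
    (Summable fun j : ℕ =>
      |(-1 : ℝ) ^ ((j + 1) + 1) *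
          (riemannZeta ((1 + 2 * s - 2 * ((j : ℝ) + 1) : ℝ) : ℂ)).re *
          q ^ (2 * (j + 1)) / (Nat.factorial (2 * (j + 1)) : ℝ)|) ∧
    ∑' m : ℕ, 4 * Real.sin (q * ((m : ℝ) + 1) / 2) ^ 2 / ((m : ℝ) + 1) ^ (1 + 2 * s)
      = -2 * Real.Gamma (-(2 * s)) * Real.cos (Real.pi * s) * |q| ^ (2 * s)
        + 2 * ∑' j : ℕ,
            (-1 : ℝ) ^ ((j + 1) + 1) *
              (riemannZeta ((1 + 2 * s - 2 * ((j : ℝ) + 1) : ℝ) : ℂ)).re *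
              q ^ (2 * (j + 1)) / (Nat.factorial (2 * (j + 1)) : ℝ) := by
  rcases eq_or_ne q 0 with rfl | hq0
  · simp [Real.zero_rpow (mul_pos two_pos hs).ne', summable_zero]
  have hsin (m : ℕ) : Real.sin (q * ((m : ℝ) + 1) / 2) ^ 2 =
      Real.sin (|q| * ((m : ℝ) + 1) / 2) ^ 2 := by
    rcases abs_choice q with h | h <;> simp [h, neg_mul, neg_div]
  have hpow (j : ℕ) : q ^ (2 * (j + 1)) = |q| ^ (2 * (j + 1)) := by
    rw [pow_mul, pow_mul, sq_abs]
  simp only [hsin, hpow]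
  have h := hasSum_re_expansion hns (abs_pos.mpr hq0) (by linarith [Real.pi_pos])
  rw [← hasSum_nat_add_iff' 1] at h
  have h' : HasSum (fun j : ℕ ↦ (-1 : ℝ) ^ ((j + 1) + 1) *
      (riemannZeta ((1 + 2 * s - 2 * ((j : ℝ) + 1) : ℝ) : ℂ)).re *
      |q| ^ (2 * (j + 1)) / (Nat.factorial (2 * (j + 1)) : ℝ)) _ :=
    h.neg.congr_fun fun j ↦ by
      rw [pow_succ (-1 : ℝ) (j + 1)]
      push_cast
      ring
  refine ⟨h'.summable.abs, ?_⟩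
  rw [h'.tsum_eq, (hasSum_four_mul_sin_sq (by linarith) |q|).tsum_eq]
  simp
  ring
end

section
/- For every integer k ≥ 1, the function s ↦ −2 Γ(−2s) cos(πs) tends to π (−1)^{k+1} / (2k−1)! as s tends to (2k−1)/2 through real values s ≠ (2k−1)/2 (with 2s not a nonnegative integer, so that Γ(−2s) is defined by analytic continuation near these points). -/
/-- A form of Euler's reflection formula in which the zeros of `cos (π s)` have been cancelled. -/
theorem neg_two_mul_Gamma_mul_cos_eq {s : ℝ} (hcos : Real.cos (Real.pi * s) ≠ 0)
    (hsin : Real.sin (Real.pi * s) ≠ 0) (hGamma : Real.Gamma (1 + 2 * s) ≠ 0) :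
    -2 * Real.Gamma (-(2 * s)) * Real.cos (Real.pi * s) =
      Real.pi / (Real.sin (Real.pi * s) * Real.Gamma (1 + 2 * s)) := by
  have h := Real.Gamma_mul_Gamma_one_sub (-(2 * s))
  rw [sub_neg_eq_add, show Real.pi * -(2 * s) = -(2 * (Real.pi * s)) by ring, Real.sin_neg,
    Real.sin_two_mul, eq_div_iff (by simp [hcos, hsin])] at h
  rw [eq_div_iff (mul_ne_zero hsin hGamma)]
  linear_combination h

/-- The zeros of `cos (π s)` are isolated. -/
theorem eventually_cos_pi_mul_ne_zero (m : ℤ) :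
    ∀ᶠ s : ℝ in nhdsWithin ((2 * m + 1) / 2) {s | s ≠ (2 * m + 1) / 2},
      Real.cos (Real.pi * s) ≠ 0 := by
  filter_upwards [self_mem_nhdsWithin,
    mem_nhdsWithin_of_mem_nhds (Metric.ball_mem_nhds _ one_pos)] with s hne hball hcos
  obtain ⟨j, hj⟩ := Real.cos_eq_zero_iff.mp hcos
  have hs : s = (2 * j + 1) / 2 := by
    apply mul_left_cancel₀ Real.pi_ne_zero
    linear_combination hj
  rw [Metric.mem_ball, Real.dist_eq, hs,
    show ((2 * j + 1) / 2 - (2 * m + 1) / 2 : ℝ) = ((j - m : ℤ) : ℝ) by push_cast; ring,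
    ← Int.cast_abs, ← Int.cast_one, Int.cast_lt, Int.abs_lt_one_iff, sub_eq_zero] at hball
  exact hne (hball ▸ hs)

/-- For every integer `k ≥ 1`,
`−2 Γ(−2s) cos(πs) → π (−1)^{k+1} / (2k−1)!` as `s → (2k−1)/2` with `s ≠ (2k−1)/2`. -/
theorem gamma_cos_removable_limit (k : ℕ) (hk : 1 ≤ k) :
    Filter.Tendsto (fun s : ℝ => -2 * Real.Gamma (-(2 * s)) * Real.cos (Real.pi * s))
      (nhdsWithin ((2 * (k : ℝ) - 1) / 2) {s : ℝ | s ≠ (2 * (k : ℝ) - 1) / 2})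
      (nhds (Real.pi * (-1 : ℝ) ^ (k + 1) / (Nat.factorial (2 * k - 1) : ℝ))) := by
  obtain ⟨m, rfl⟩ := Nat.exists_eq_add_of_le' hk
  have hpoint : (2 * ((m + 1 : ℕ) : ℝ) - 1) / 2 = (2 * ((m : ℤ) : ℝ) + 1) / 2 := by
    push_cast; ring
  rw [hpoint, show 2 * (m + 1) - 1 = 2 * m + 1 by omega]
  set a : ℝ := (2 * ((m : ℤ) : ℝ) + 1) / 2 with ha
  have hsin : Real.sin (Real.pi * a) = (-1) ^ m := by
    rw [show Real.pi * a = Real.pi / 2 + m * Real.pi by rw [ha]; push_cast; ring,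
      Real.sin_add_nat_mul_pi, Real.sin_pi_div_two, mul_one]
  have hGamma : Real.Gamma (1 + 2 * a) = (2 * m + 1).factorial := by
    rw [← Real.Gamma_nat_eq_factorial, ha]
    congr 1
    push_cast; ring
  have hsin_ne : Real.sin (Real.pi * a) ≠ 0 := by simp [hsin]
  have hGamma_ne : Real.Gamma (1 + 2 * a) ≠ 0 := by
    rw [hGamma]; exact_mod_cast Nat.factorial_ne_zero _
  have hsin_cont : ContinuousAt (fun s : ℝ => Real.sin (Real.pi * s)) a := by fun_prop
  have hGamma_cont : ContinuousAt (fun s : ℝ => Real.Gamma (1 + 2 * s)) a := by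
    refine ContinuousAt.comp (f := fun s : ℝ => 1 + 2 * s) (g := Real.Gamma) ?_ (by fun_prop)
    refine (Real.differentiableAt_Gamma fun n hn => ?_).continuousAt
    have ha_pos : 0 < a := by rw [ha]; push_cast; positivity
    have : (0 : ℝ) ≤ n := n.cast_nonneg
    linarith
  have hlim : Real.pi * (-1 : ℝ) ^ (m + 1 + 1) / ((2 * m + 1).factorial : ℝ) =
      Real.pi / (Real.sin (Real.pi * a) * Real.Gamma (1 + 2 * a)) := by
    rw [hsin, hGamma, pow_succ, pow_succ]
    rcases neg_one_pow_eq_or ℝ m with h | h <;> rw [h] <;> ring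
  rw [hlim]
  refine Filter.Tendsto.congr' ?_ ((continuousAt_const.div (hsin_cont.mul hGamma_cont)
    (mul_ne_zero hsin_ne hGamma_ne)).tendsto.mono_left nhdsWithin_le_nhds)
  filter_upwards [eventually_cos_pi_mul_ne_zero m,
    (hsin_cont.eventually_ne hsin_ne).filter_mono nhdsWithin_le_nhds,
    (hGamma_cont.eventually_ne hGamma_ne).filter_mono nhdsWithin_le_nhds] with s hc hs hG
  exact (neg_two_mul_Gamma_mul_cos_eq hc hs hG).symm
end

section
/- Let J = {J_m}_{m∈ℤ} be a sequence of reals with J_m ≥ 0, J_{-m} = J_m, J_0 = 0, and ∑_{m∈ℤ} J_m < ∞, let κ ∈ ℝ, and suppose G ∈ ℓ²(ℤ;ℝ) satisfies, for every n ∈ ℤ, 0 = κ G_n − ∑_{m∈ℤ} J_{|m−n|}(G_m − G_n) − G_n³. Then ∑_{n∈ℤ} G_n⁴ = κ ∑_{n∈ℤ} G_n² + (1/2) ∑_{m∈ℤ, m≠0} ∑_{n∈ℤ} J_{|m|} (G_{m+n} − G_n)², where all series converge absolutely. -/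
open scoped BigOperators

/-- The reflection `(k, n) ↦ (-k, k + n)`, which exchanges the two endpoints of a bond. -/
def bondReversal : ℤ × ℤ ≃ ℤ × ℤ :=
  Equiv.prodShear (Equiv.neg ℤ) Equiv.addLeft

@[simp]
theorem bondReversal_apply (p : ℤ × ℤ) : bondReversal p = (-p.1, p.1 + p.2) := rfl

section SummationByParts

variable {J G : ℤ → ℝ}

theorem summable_mul_sq_prod (hJnonneg : ∀ m, 0 ≤ J m) (hJsum : Summable J)
    (hG : Summable fun n => G n ^ 2) :
    Summable fun p : ℤ × ℤ => J p.1 * G p.2 ^ 2 :=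
  hJsum.mul_of_nonneg hG hJnonneg fun _ => sq_nonneg _

theorem summable_mul_shift_sq_prod (hJnonneg : ∀ m, 0 ≤ J m) (hJsymm : ∀ m, J (-m) = J m)
    (hJsum : Summable J) (hG : Summable fun n => G n ^ 2) :
    Summable fun p : ℤ × ℤ => J p.1 * G (p.1 + p.2) ^ 2 := by
  have h := bondReversal.summable_iff.mpr (summable_mul_sq_prod hJnonneg hJsum hG)
  simpa [Function.comp_def, hJsymm] using h

theorem summable_mul_sub_sq_prod (hJnonneg : ∀ m, 0 ≤ J m) (hJsymm : ∀ m, J (-m) = J m)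
    (hJsum : Summable J) (hG : Summable fun n => G n ^ 2) :
    Summable fun p : ℤ × ℤ => J p.1 * (G (p.1 + p.2) - G p.2) ^ 2 := by
  refine Summable.of_nonneg_of_le (fun p => mul_nonneg (hJnonneg _) (sq_nonneg _)) (fun p => ?_)
    (((summable_mul_shift_sq_prod hJnonneg hJsymm hJsum hG).add
      (summable_mul_sq_prod hJnonneg hJsum hG)).mul_left 2)
  nlinarith [mul_nonneg (hJnonneg p.1) (sq_nonneg (G (p.1 + p.2) + G p.2))]

theorem summable_mul_sub_mul_prod (hJnonneg : ∀ m, 0 ≤ J m) (hJsymm : ∀ m, J (-m) = J m)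
    (hJsum : Summable J) (hG : Summable fun n => G n ^ 2) :
    Summable fun p : ℤ × ℤ => J p.1 * (G (p.1 + p.2) - G p.2) * G p.2 := by
  refine Summable.of_norm_bounded ((summable_mul_sub_sq_prod hJnonneg hJsymm hJsum hG).add
    (summable_mul_sq_prod hJnonneg hJsum hG)) (fun p => ?_)
  have hJ := hJnonneg p.1
  rw [Real.norm_eq_abs, abs_le]
  constructor <;>
    nlinarith [mul_nonneg hJ (sq_nonneg (G (p.1 + p.2) - G p.2 + G p.2)),
      mul_nonneg hJ (sq_nonneg (G (p.1 + p.2) - G p.2 - G p.2)),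
      mul_nonneg hJ (sq_nonneg (G (p.1 + p.2) - G p.2)), mul_nonneg hJ (sq_nonneg (G p.2))]

/-- Summation by parts: `⟨ℒG, G⟩ = -(1/2) ∑ J_k (G_{k+n} - G_n)²`. -/
theorem tsum_mul_sub_mul_prod (hJnonneg : ∀ m, 0 ≤ J m) (hJsymm : ∀ m, J (-m) = J m)
    (hJsum : Summable J) (hG : Summable fun n => G n ^ 2) :
    ∑' p : ℤ × ℤ, J p.1 * (G (p.1 + p.2) - G p.2) * G p.2
      = -(1 / 2) * ∑' p : ℤ × ℤ, J p.1 * (G (p.1 + p.2) - G p.2) ^ 2 := by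
  have hS := summable_mul_sub_mul_prod hJnonneg hJsymm hJsum hG
  have hQ := summable_mul_sub_sq_prod hJnonneg hJsymm hJsum hG
  have hrev := bondReversal.tsum_eq
    fun p : ℤ × ℤ => J p.1 * (G (p.1 + p.2) - G p.2) * G p.2
  have hsplit (p : ℤ × ℤ) :
      J (bondReversal p).1 * (G ((bondReversal p).1 + (bondReversal p).2) - G (bondReversal p).2)
          * G (bondReversal p).2
        = -(J p.1 * (G (p.1 + p.2) - G p.2) ^ 2)
          - J p.1 * (G (p.1 + p.2) - G p.2) * G p.2 := by
    simp only [bondReversal_apply, hJsymm, neg_add_cancel_left]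
    ring
  rw [tsum_congr hsplit, hQ.neg.tsum_sub hS, tsum_neg] at hrev
  linarith

end SummationByParts

/-- Virial identity for real `ℓ²` solutions of the nonlocal DNLS standing
wave equation: `∑_n G_n⁴ = κ ∑_n G_n² + (1/2) ∑_{m≠0} ∑_n J_{|m|} (G_{m+n} − G_n)²`,
all series converging absolutely. -/
theorem nonlocal_virial_identity
    (J : ℤ → ℝ) (hJnonneg : ∀ m : ℤ, 0 ≤ J m) (hJsymm : ∀ m : ℤ, J (-m) = J m)
    (hJzero : J 0 = 0) (hJsum : Summable J)
    (κ : ℝ) (G : ℤ → ℝ) (hG : Summable fun n : ℤ => G n ^ 2)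
    (heq : ∀ n : ℤ,
      0 = κ * G n - (∑' m : ℤ, J (|m - n|) * (G m - G n)) - G n ^ 3) :
    (Summable fun n : ℤ => G n ^ 4) ∧
    (Summable fun p : {m : ℤ // m ≠ 0} × ℤ =>
      J (|p.1.1|) * (G (p.1.1 + p.2) - G p.2) ^ 2) ∧
    ∑' n : ℤ, G n ^ 4
      = κ * ∑' n : ℤ, G n ^ 2
        + (1 / 2) * ∑' m : {m : ℤ // m ≠ 0}, ∑' n : ℤ, J (|m.1|) * (G (m.1 + n) - G n) ^ 2 := by
  have hJabs (m : ℤ) : J |m| = J m := by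
    rcases abs_choice m with h | h <;> rw [h]
    exact hJsymm m
  simp only [hJabs] at heq ⊢
  have hS := summable_mul_sub_mul_prod hJnonneg hJsymm hJsum hG
  have hQ := summable_mul_sub_sq_prod hJnonneg hJsymm hJsum hG
  have hpow (n : ℤ) : G n ^ 4
      = κ * G n ^ 2 - ∑' k : ℤ, J k * (G (k + n) - G n) * G n := by
    have hshift : ∑' k : ℤ, J k * (G (k + n) - G n) = ∑' m : ℤ, J (m - n) * (G m - G n) := by
      rw [← (Equiv.addRight n).tsum_eq fun m : ℤ => J (m - n) * (G m - G n)]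
      simp
    rw [tsum_mul_right, hshift]
    linear_combination G n * heq n
  have hSn : Summable fun n : ℤ => ∑' k : ℤ, J k * (G (k + n) - G n) * G n :=
    hS.prod_symm.prod
  have hsum : ∑' n : ℤ, ∑' k : ℤ, J k * (G (k + n) - G n) * G n
      = -(1 / 2) * ∑' p : ℤ × ℤ, J p.1 * (G (p.1 + p.2) - G p.2) ^ 2 := by
    rw [← tsum_mul_sub_mul_prod hJnonneg hJsymm hJsum hG, ← (Equiv.prodComm ℤ ℤ).tsum_eq]
    exact hS.prod_symm.tsum_prod.symm
  have hsub : ∑' m : {m : ℤ // m ≠ 0}, ∑' n : ℤ, J m.1 * (G (m.1 + n) - G n) ^ 2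
      = ∑' p : ℤ × ℤ, J p.1 * (G (p.1 + p.2) - G p.2) ^ 2 := by
    rw [hQ.tsum_prod]
    refine tsum_subtype_eq_of_support_subset (s := {m : ℤ | m ≠ 0})
      (f := fun m : ℤ => ∑' n : ℤ, J m * (G (m + n) - G n) ^ 2) fun m hm h0 => hm ?_
    simp [h0, hJzero]
  refine ⟨?_, ?_, ?_⟩
  · simpa only [hpow] using (hG.mul_left κ).sub hSn
  · exact hQ.comp_injective (Subtype.val_injective.prodMap Function.injective_id)
  · rw [tsum_congr hpow, (hG.mul_left κ).tsum_sub hSn, tsum_mul_left, hsum, hsub]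
    ring
end
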